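/- Let 𝔤 be a Lie algebra over k. For each t ∈ k, the product x ⋆_t y := Σ_{p=0}^∞ B_p(x,y)·t^p (a finite sum for each pair x, y) makes S𝔤 into an associative unital k-algebra; moreover ⋆_0 is the commutative product of S𝔤 and x ⋆_1 y = B(x,y) = e^{-1}(e(x)e(y)). -/

import Mathlib

noncomputable section

/-- The degree-`n` homogeneous component `S^n` of the symmetric algebra:
the span of `n`-fold products of elements of `𝔤` (realized as the `n`-th power of the
submodule `ι(𝔤) ⊆ S`). -/
def Sdeg (k : Type) [Field k] (L : Type) [LieRing L] [LieAlgebra k L]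
    (S : Type) [CommRing S] [Algebra k S] (ι : L →ₗ[k] S) (n : ℕ) : Submodule k S :=
  (LinearMap.range ι) ^ n

/-- `(S, ι)` is a model of the symmetric algebra of the Lie algebra `L`:
`S` is commutative and generated as a `k`-algebra by the image of `ι`. -/
def IsSymmAlg (k : Type) [Field k] (L : Type) [LieRing L] [LieAlgebra k L]
    (S : Type) [CommRing S] [Algebra k S] (ι : L →ₗ[k] S) : Prop :=
  Algebra.adjoin k (Set.range ι) = ⊤

/-- `e : S → U𝔤` is the symmetrization map: it sends a monomial `g₁ ⋯ g_p` to
`(1/p!) ∑_{σ ∈ S_p} g_{σ(1)} ⋯ g_{σ(p)}`. -/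
def IsSymmetrization (k : Type) [Field k] (L : Type) [LieRing L] [LieAlgebra k L]
    (S : Type) [CommRing S] [Algebra k S] (ι : L →ₗ[k] S)
    (e : S →ₗ[k] UniversalEnvelopingAlgebra k L) : Prop :=
  ∀ l : List L,
    e (l.map ι).prod = ((l.length.factorial : k)⁻¹) •
      ∑ σ : Equiv.Perm (Fin l.length),
        (List.ofFn fun i => UniversalEnvelopingAlgebra.ι k (l.get (σ i))).prod

/-- `B : ℕ → S →ₗ S →ₗ S` is the family of homogeneous components `B_p` of the product
`B(x,y) = e⁻¹(e(x)e(y))`: each `B p` lowers total degree by `p` (it maps `S^n ⊗ S^m`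
to `S^{n+m-p}` and vanishes for `p > n+m`), and on homogeneous elements `x ∈ S^n`,
`y ∈ S^m` one has `e (∑_{p=0}^{n+m} B p x y) = e x * e y`, i.e.
`e⁻¹(e(x)e(y)) = ∑_p B_p(x,y)`. -/
def IsPBWComponents (k : Type) [Field k] (L : Type) [LieRing L] [LieAlgebra k L]
    (S : Type) [CommRing S] [Algebra k S] (ι : L →ₗ[k] S)
    (e : S →ₗ[k] UniversalEnvelopingAlgebra k L)
    (B : ℕ → S →ₗ[k] S →ₗ[k] S) : Prop :=
  (∀ p n m, ∀ x ∈ Sdeg k L S ι n, ∀ y ∈ Sdeg k L S ι m,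
      B p x y ∈ Sdeg k L S ι (n + m - p)) ∧
  (∀ p n m, n + m < p → ∀ x ∈ Sdeg k L S ι n, ∀ y ∈ Sdeg k L S ι m, B p x y = 0) ∧
  (∀ n m, ∀ x ∈ Sdeg k L S ι n, ∀ y ∈ Sdeg k L S ι m,
      e (∑ p ∈ Finset.range (n + m + 1), B p x y) = e x * e y)


open scoped BigOperators

section Independence

variable {k : Type} [Field k]

/-- In a module over an infinite field, the coefficients of a polynomial expression all of whose
values lie in a submodule lie in that submodule. -/
lemma Submodule.coeff_mem_of_forall_sum_pow_smul_mem [Infinite k] {M : Type*} [AddCommGroup M]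
    [Module k M] (W : Submodule k M) (n : ℕ) (a : ℕ → M)
    (h : ∀ c : k, ∑ i ∈ Finset.range n, c ^ i • a i ∈ W) {i : ℕ} (hi : i < n) : a i ∈ W := by
  rw [← Submodule.Quotient.mk_eq_zero W, ← Module.forall_dual_apply_eq_zero_iff k]
  intro f
  have hp : ∑ j ∈ Finset.range n, Polynomial.monomial j (f (Submodule.Quotient.mk (a j))) = 0 := by
    refine Polynomial.funext fun c => ?_
    have hc := congrArg f ((Submodule.Quotient.mk_eq_zero W).2 (h c))
    rw [← Submodule.mkQ_apply] at hc
    simpa [Polynomial.eval_finsetSum, mul_comm] using hc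
  simpa [Polynomial.finsetSum_coeff, Polynomial.coeff_monomial, hi] using
    congrArg (fun p => Polynomial.coeff p i) hp

/-- Polarization: in characteristic zero, the `n`-th power of a submodule of a commutative algebra
is spanned by the `n`-th powers of its elements. -/
lemma Submodule.pow_le_span_pow [CharZero k] {S : Type*} [CommRing S] [Algebra k S]
    (M : Submodule k S) (n : ℕ) : M ^ n ≤ Submodule.span k ((fun y => y ^ n) '' (M : Set S)) := by
  induction n with
  | zero =>
    rw [pow_zero, Submodule.one_le]
    exact Submodule.subset_span ⟨0, M.zero_mem, pow_zero _⟩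
  | succ n ih =>
    rw [pow_succ']
    refine Submodule.mul_le.2 fun x hx w hw => ?_
    replace hw := ih hw
    induction hw using Submodule.span_induction with
    | zero => simp
    | add u v _ _ hu hv => rw [mul_add]; exact add_mem hu hv
    | smul c u _ hu => rw [mul_smul_comm]; exact Submodule.smul_mem _ _ hu
    | mem u hu =>
      obtain ⟨y, hy, rfl⟩ := hu
      have key := Submodule.coeff_mem_of_forall_sum_pow_smul_mem
        (Submodule.span k ((fun y => y ^ (n + 1)) '' (M : Set S))) (n + 1 + 1)
        (fun i => ((n + 1).choose i : k) • (x ^ i * y ^ (n + 1 - i))) (fun c => by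
          refine Submodule.subset_span
            ⟨c • x + y, M.add_mem (M.smul_mem c hx) hy, ?_⟩
          simp only [add_pow, smul_pow]
          refine Finset.sum_congr rfl fun i _ => ?_
          simp only [Algebra.smul_def, map_natCast]
          ring) (i := 1) (by omega)
      simp only [Nat.choose_one_right, pow_one, Nat.add_sub_cancel] at key
      exact (Submodule.smul_mem_iff _ (Nat.cast_ne_zero.2 n.succ_ne_zero)).1 key

variable (k) (L : Type) [LieRing L] [LieAlgebra k L]

open TensorProduct

attribute [local instance] LieRing.ofAssociativeRing

/-- The Lie algebra morphism `x ↦ f x ⊗ 1 + 1 ⊗ f x` making the elements of `L` primitive. -/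
def LieHom.primitive {A : Type} [Ring A] [Algebra k A] (f : L →ₗ⁅k⁆ A) : L →ₗ⁅k⁆ A ⊗[k] A :=
  { toFun x := f x ⊗ₜ 1 + 1 ⊗ₜ f x
    map_add' x y := by
      rw [map_add, TensorProduct.add_tmul, TensorProduct.tmul_add]
      abel
    map_smul' c x := by
      simp only [map_smul, TensorProduct.smul_tmul', TensorProduct.tmul_smul, smul_add,
        RingHom.id_apply]
    map_lie' := by
      intro x y
      simp only [LieHom.map_lie, LieRing.of_associative_ring_bracket, add_mul, mul_add,
        TensorProduct.sub_tmul, TensorProduct.tmul_sub, Algebra.TensorProduct.tmul_mul_tmul,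
        one_mul, mul_one]
      abel }

/-- The coproduct of the universal enveloping algebra, for which elements of `L` are primitive. -/
def UniversalEnvelopingAlgebra.coproduct : UniversalEnvelopingAlgebra k L →ₐ[k]
    UniversalEnvelopingAlgebra k L ⊗[k] UniversalEnvelopingAlgebra k L :=
  UniversalEnvelopingAlgebra.lift k (LieHom.primitive k L (UniversalEnvelopingAlgebra.ι k))

/-- The second Adams operation (convolution square of the identity) of the universal enveloping
algebra. -/
def UniversalEnvelopingAlgebra.adamsTwo : Module.End k (UniversalEnvelopingAlgebra k L) :=
  LinearMap.mul' k _ ∘ₗ (UniversalEnvelopingAlgebra.coproduct k L).toLinearMap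

variable {L}

lemma UniversalEnvelopingAlgebra.adamsTwo_ι_pow (y : L) (n : ℕ) :
    adamsTwo k L (ι k y ^ n) = (2 : k) ^ n • ι k y ^ n := by
  have h : coproduct k L (ι k y) = ι k y ⊗ₜ[k] 1 + 1 ⊗ₜ[k] ι k y := by
    rw [coproduct, lift_ι_apply]
    rfl
  have hc : Commute (ι k y ⊗ₜ[k] (1 : UniversalEnvelopingAlgebra k L))
      ((1 : UniversalEnvelopingAlgebra k L) ⊗ₜ[k] ι k y) := by
    simp [Commute, SemiconjBy]
  have h2 : (2 : k) ^ n = ∑ i ∈ Finset.range (n + 1), (n.choose i : k) := by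
    rw [← Nat.cast_sum, Nat.sum_range_choose]; simp
  rw [adamsTwo, LinearMap.comp_apply, AlgHom.toLinearMap_apply, map_pow, h, hc.add_pow, map_sum,
    h2, Finset.sum_smul]
  refine Finset.sum_congr rfl fun i hi => ?_
  have hin : i + (n - i) = n := by have := Finset.mem_range.1 hi; omega
  rw [← Nat.cast_comm, ← nsmul_eq_mul, map_nsmul, Nat.cast_smul_eq_nsmul]
  simp [Algebra.TensorProduct.tmul_pow, ← pow_add, hin]

variable {k} {S : Type} [CommRing S] [Algebra k S] {ι : L →ₗ[k] S}
  {e : S →ₗ[k] UniversalEnvelopingAlgebra k L}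

lemma IsSymmetrization.apply_pow [CharZero k] (he : IsSymmetrization k L S ι e) (y : L) (n : ℕ) :
    e (ι y ^ n) = UniversalEnvelopingAlgebra.ι k y ^ n := by
  have h := he (List.replicate n y)
  have hn : (n.factorial : k) ≠ 0 := Nat.cast_ne_zero.2 n.factorial_ne_zero
  simpa [List.ofFn_const, Fintype.card_perm, ← Nat.cast_smul_eq_nsmul k, smul_smul, hn] using h

lemma IsSymmetrization.adamsTwo_apply [CharZero k] (he : IsSymmetrization k L S ι e) {n : ℕ}
    {x : S} (hx : x ∈ Sdeg k L S ι n) :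
    UniversalEnvelopingAlgebra.adamsTwo k L (e x) = (2 : k) ^ n • e x := by
  replace hx := Submodule.pow_le_span_pow _ n hx
  induction hx using Submodule.span_induction with
  | zero => simp
  | add u v _ _ hu hv => simp [hu, hv]
  | smul c u _ hu => rw [map_smul, map_smul, hu, smul_comm c]
  | mem u hu =>
    obtain ⟨_, ⟨y, rfl⟩, rfl⟩ := hu
    simp only [he.apply_pow, UniversalEnvelopingAlgebra.adamsTwo_ι_pow]

/-- The homogeneous components of `S` are independent, since the injective symmetrization map
sends them into distinct eigenspaces of the second Adams operation. -/
lemma IsSymmetrization.iSupIndep_Sdeg [CharZero k] (he : IsSymmetrization k L S ι e)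
    (hinj : Function.Injective e) : iSupIndep (Sdeg k L S ι) := by
  have h2 : Function.Injective fun n : ℕ => (2 : k) ^ n := fun a b h => by
    have h' : ((2 ^ a : ℕ) : k) = ((2 ^ b : ℕ) : k) := by push_cast; exact h
    exact Nat.pow_right_injective le_rfl (Nat.cast_injective h')
  have h := (Module.End.eigenspaces_iSupIndep
    (UniversalEnvelopingAlgebra.adamsTwo k L)).comp h2
  rw [iSupIndep_iff_finsetSum_eq_zero_imp_eq_zero] at h ⊢
  intro s v hv hs i hi
  refine hinj ?_
  rw [map_zero]
  refine h s (fun j => e (v j)) (fun j hj => ?_) ?_ i hi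
  · exact Module.End.mem_eigenspace_iff.2 (he.adamsTwo_apply (hv j hj))
  · rw [← map_sum, hs, map_zero]

end Independence

section Filtration

variable {k : Type} [Field k] {L : Type} [LieRing L] [LieAlgebra k L]
  {S : Type} [CommRing S] [Algebra k S] {ι : L →ₗ[k] S}
  {e : S →ₗ[k] UniversalEnvelopingAlgebra k L}

lemma list_prod_mem_Sdeg (l : List L) : (l.map ι).prod ∈ Sdeg k L S ι l.length := by
  induction l with
  | nil => exact Submodule.one_le.1 (pow_zero _).ge
  | cons a l ih =>
    rw [List.map_cons, List.prod_cons, List.length_cons, Sdeg, pow_succ']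
    exact Submodule.mul_mem_mul ⟨a, rfl⟩ ih

lemma Sdeg_le_span_list_prod (n : ℕ) : Sdeg k L S ι n ≤
    Submodule.span k {x | ∃ l : List L, l.length = n ∧ (l.map ι).prod = x} := by
  induction n with
  | zero =>
    rw [Sdeg, pow_zero, Submodule.one_le]
    exact Submodule.subset_span ⟨[], rfl, rfl⟩
  | succ n ih =>
    rw [Sdeg, pow_succ']
    refine Submodule.mul_le.2 ?_
    rintro _ ⟨a, rfl⟩ w hw
    replace hw := ih hw
    induction hw using Submodule.span_induction with
    | zero => simp
    | add u v _ _ hu hv => rw [mul_add]; exact add_mem hu hv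
    | smul c u _ hu => rw [mul_smul_comm]; exact Submodule.smul_mem _ _ hu
    | mem u hu =>
      obtain ⟨l, rfl, rfl⟩ := hu
      exact Submodule.subset_span ⟨a :: l, rfl, by simp⟩

lemma IsSymmAlg.iSup_Sdeg (hS : IsSymmAlg k L S ι) : ⨆ n, Sdeg k L S ι n = ⊤ := by
  rw [eq_top_iff, ← Algebra.top_toSubmodule, ← hS, Algebra.adjoin_eq_span, Submodule.span_le]
  intro x hx
  obtain ⟨n, hn⟩ : ∃ n, x ∈ Sdeg k L S ι n := by
    induction hx using Submonoid.closure_induction with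
    | mem x hx =>
      obtain ⟨a, rfl⟩ := hx
      exact ⟨1, by rw [Sdeg, pow_one]; exact ⟨a, rfl⟩⟩
    | one => exact ⟨0, Submodule.one_le.1 (pow_zero _).ge⟩
    | mul x y _ _ hx hy =>
      obtain ⟨n, hn⟩ := hx
      obtain ⟨m, hm⟩ := hy
      exact ⟨n + m, by rw [Sdeg, pow_add]; exact Submodule.mul_mem_mul hn hm⟩
  exact Submodule.mem_iSup_of_mem n hn

variable (k L) in
/-- The span in the universal enveloping algebra of the products of fewer than `n` elements
of `L`. -/
def UniversalEnvelopingAlgebra.filtrationLT (n : ℕ) :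
    Submodule k (UniversalEnvelopingAlgebra k L) :=
  Submodule.span k {u | ∃ l : List L, l.length < n ∧ (l.map (UniversalEnvelopingAlgebra.ι k)).prod = u}

namespace UniversalEnvelopingAlgebra

lemma ι_mul_mem_filtrationLT (a : L) {n : ℕ} {u : UniversalEnvelopingAlgebra k L}
    (hu : u ∈ filtrationLT k L n) :
    UniversalEnvelopingAlgebra.ι k a * u ∈ filtrationLT k L (n + 1) := by
  induction hu using Submodule.span_induction with
  | zero => simp
  | add u v _ _ hu hv => rw [mul_add]; exact add_mem hu hv
  | smul c u _ hu => rw [mul_smul_comm]; exact Submodule.smul_mem _ _ hu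
  | mem u hu =>
    obtain ⟨l, hl, rfl⟩ := hu
    exact Submodule.subset_span ⟨a :: l, by simpa using hl, by rw [List.map_cons, List.prod_cons]⟩

/-- Reordering the factors of a product of elements of `L` changes it by shorter products. -/
lemma prod_sub_prod_mem_filtrationLT {l l' : List L} (h : l.Perm l') :
    (l.map (UniversalEnvelopingAlgebra.ι k)).prod -
      (l'.map (UniversalEnvelopingAlgebra.ι k)).prod ∈ filtrationLT k L l.length := by
  induction h with
  | nil => simp
  | cons a _ ih =>
    simp only [List.map_cons, List.prod_cons, List.length_cons, ← mul_sub]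
    exact ι_mul_mem_filtrationLT a ih
  | swap a b l =>
    refine Submodule.subset_span ⟨⁅b, a⁆ :: l, by simp, ?_⟩
    simp only [List.map_cons, List.prod_cons, LieHom.map_lie,
      LieRing.of_associative_ring_bracket, sub_mul, mul_assoc]
  | trans h₁ _ ih₁ ih₂ =>
    rw [← h₁.length_eq] at ih₂
    simpa using add_mem ih₁ ih₂

lemma filtrationLT_mono {n m : ℕ} (h : n ≤ m) : filtrationLT k L n ≤ filtrationLT k L m :=
  Submodule.span_mono fun _ ⟨l, hl, hu⟩ => ⟨l, hl.trans_le h, hu⟩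

lemma mul_mem_filtrationLT {n m N : ℕ} (h : n + m ≤ N + 1) {u v : UniversalEnvelopingAlgebra k L}
    (hu : u ∈ filtrationLT k L n) (hv : v ∈ filtrationLT k L m) :
    u * v ∈ filtrationLT k L N := by
  refine (?_ : filtrationLT k L n * filtrationLT k L m ≤ filtrationLT k L N)
    (Submodule.mul_mem_mul hu hv)
  rw [filtrationLT, filtrationLT, Submodule.span_mul_span, Submodule.span_le]
  rintro _ ⟨_, ⟨l₁, h₁, rfl⟩, _, ⟨l₂, h₂, rfl⟩, rfl⟩
  refine Submodule.subset_span ⟨l₁ ++ l₂, by rw [List.length_append]; omega, ?_⟩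
  rw [List.map_append, List.prod_append]

end UniversalEnvelopingAlgebra

open UniversalEnvelopingAlgebra

lemma IsSymmetrization.apply_prod_sub_mem [CharZero k] (he : IsSymmetrization k L S ι e)
    (l : List L) : e (l.map ι).prod - (l.map (UniversalEnvelopingAlgebra.ι k)).prod ∈
      filtrationLT k L l.length := by
  have hn : (l.length.factorial : k) ≠ 0 := Nat.cast_ne_zero.2 (Nat.factorial_ne_zero _)
  have h : (l.map (UniversalEnvelopingAlgebra.ι k)).prod = (l.length.factorial : k)⁻¹ •
      ∑ _σ : Equiv.Perm (Fin l.length), (l.map (UniversalEnvelopingAlgebra.ι k)).prod := by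
    rw [Finset.sum_const, Finset.card_univ, Fintype.card_perm, Fintype.card_fin,
      ← Nat.cast_smul_eq_nsmul k, smul_smul, inv_mul_cancel₀ hn, one_smul]
  rw [h, he l, ← smul_sub, ← Finset.sum_sub_distrib]
  refine Submodule.smul_mem _ _ (Submodule.sum_mem _ fun σ _ => ?_)
  have hp : (List.ofFn (l.get ∘ σ)).Perm l := by
    simpa only [List.ofFn_get] using σ.ofFn_comp_perm l.get
  have hm := prod_sub_prod_mem_filtrationLT (k := k) hp
  rwa [List.map_ofFn, hp.length_eq] at hm

lemma IsSymmetrization.filtrationLT_le_map [CharZero k] (he : IsSymmetrization k L S ι e)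
    (n : ℕ) : filtrationLT k L n ≤ (⨆ i, ⨆ (_ : i < n), Sdeg k L S ι i).map e := by
  induction n using Nat.strong_induction_on with
  | _ n ih =>
  refine Submodule.span_le.2 ?_
  rintro _ ⟨l, hl, rfl⟩
  have h1 : e (l.map ι).prod ∈ (⨆ i, ⨆ (_ : i < n), Sdeg k L S ι i).map e :=
    Submodule.mem_map_of_mem
      (Submodule.mem_iSup_of_mem l.length (Submodule.mem_iSup_of_mem hl (list_prod_mem_Sdeg l)))
  have hmono : ⨆ i, ⨆ (_ : i < l.length), Sdeg k L S ι i ≤ ⨆ i, ⨆ (_ : i < n), Sdeg k L S ι i :=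
    iSup_mono fun i => iSup_const_mono fun h => h.trans hl
  have h2 := Submodule.map_mono (f := e) hmono
    (ih _ hl (he.apply_prod_sub_mem l))
  simpa using sub_mem h1 h2

/-- The symmetrization map is multiplicative up to terms of lower degree. -/
lemma IsSymmetrization.mul_sub_apply_mul_mem [CharZero k] (he : IsSymmetrization k L S ι e)
    {n m : ℕ} {x y : S} (hx : x ∈ Sdeg k L S ι n) (hy : y ∈ Sdeg k L S ι m) :
    e x * e y - e (x * y) ∈ (⨆ i, ⨆ (_ : i < n + m), Sdeg k L S ι i).map e := by
  let Φ := (LinearMap.mul k (UniversalEnvelopingAlgebra k L)).compl₁₂ e e -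
    (LinearMap.mul k S).compr₂ e
  refine (?_ : Submodule.map₂ Φ _ _ ≤ _) (Submodule.apply_mem_map₂ Φ
    (Sdeg_le_span_list_prod n hx) (Sdeg_le_span_list_prod m hy))
  rw [Submodule.map₂_span_span, Submodule.span_le]
  rintro _ ⟨_, ⟨l₁, rfl, rfl⟩, _, ⟨l₂, rfl, rfl⟩, rfl⟩
  refine he.filtrationLT_le_map _ ?_
  have h₁ := he.apply_prod_sub_mem l₁
  have h₂ := he.apply_prod_sub_mem l₂
  have h₁₂ := he.apply_prod_sub_mem (l₁ ++ l₂)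
  rw [List.map_append, List.map_append, List.prod_append, List.prod_append,
    List.length_append] at h₁₂
  have hu₁ : (l₁.map (UniversalEnvelopingAlgebra.ι k)).prod ∈ filtrationLT k L (l₁.length + 1) :=
    Submodule.subset_span ⟨l₁, Nat.lt_succ_self _, rfl⟩
  have hu₂ : (l₂.map (UniversalEnvelopingAlgebra.ι k)).prod ∈ filtrationLT k L (l₂.length + 1) :=
    Submodule.subset_span ⟨l₂, Nat.lt_succ_self _, rfl⟩
  have he₂ : e (l₂.map ι).prod ∈ filtrationLT k L (l₂.length + 1) := by
    simpa using add_mem (filtrationLT_mono (Nat.le_succ _) h₂) hu₂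
  have key := sub_mem (add_mem
    (mul_mem_filtrationLT (N := l₁.length + l₂.length) (by omega) h₁ he₂)
    (mul_mem_filtrationLT (N := l₁.length + l₂.length) (by omega) hu₁ h₂)) h₁₂
  refine (congrArg (· ∈ filtrationLT k L (l₁.length + l₂.length)) ?_).mp key
  simp only [Φ, LinearMap.sub_apply, LinearMap.compl₁₂_apply, LinearMap.compr₂_apply,
    LinearMap.mul_apply', sub_mul, mul_sub]
  abel

end Filtration

section Star

lemma Finset.sum_range_sum_range_eq_sum_antidiagonal {M : Type*} [AddCommMonoid M] (K : ℕ)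
    (g : ℕ → ℕ → M) (hg : ∀ p q, K ≤ p + q → g p q = 0) :
    ∑ q ∈ Finset.range K, ∑ p ∈ Finset.range K, g p q =
      ∑ r ∈ Finset.range K, ∑ pq ∈ Finset.HasAntidiagonal.antidiagonal r, g pq.1 pq.2 := by
  rw [Finset.sum_comm, ← Finset.sum_product' (f := g),
    ← Finset.sum_filter_of_ne (p := fun pq : ℕ × ℕ => pq.1 + pq.2 < K)
      (fun pq _ h => not_le.1 fun hK => h (hg _ _ hK)),
    ← Finset.sum_fiberwise_of_maps_to (g := fun pq : ℕ × ℕ => pq.1 + pq.2)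
      (t := Finset.range K) (fun pq h => Finset.mem_range.2 (Finset.mem_filter.1 h).2)]
  refine Finset.sum_congr rfl fun r hr => Finset.sum_congr ?_ fun _ _ => rfl
  ext pq
  simp only [Finset.mem_filter, Finset.mem_product, Finset.mem_range,
    Finset.HasAntidiagonal.mem_antidiagonal] at hr ⊢
  omega

variable {k : Type} [Field k] {L : Type} [LieRing L] [LieAlgebra k L]
  {S : Type} [CommRing S] [Algebra k S] {ι : L →ₗ[k] S}
  {e : S →ₗ[k] UniversalEnvelopingAlgebra k L} {B : ℕ → S →ₗ[k] S →ₗ[k] S}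

/-- Comparison of homogeneous components, indexed by codegree. -/
lemma eq_of_sum_range_eq_of_mem_Sdeg (hind : iSupIndep (Sdeg k L S ι)) {N : ℕ} {a b : ℕ → S}
    (ha : ∀ r ≤ N, a r ∈ Sdeg k L S ι (N - r)) (hb : ∀ r ≤ N, b r ∈ Sdeg k L S ι (N - r))
    (h : ∑ r ∈ Finset.range (N + 1), a r = ∑ r ∈ Finset.range (N + 1), b r) {r : ℕ}
    (hr : r ≤ N) : a r = b r := by
  rw [iSupIndep_iff_finsetSum_eq_zero_imp_eq_zero] at hind
  have key := hind (Finset.range (N + 1)) (fun j => a (N - j) - b (N - j)) (fun j hj => by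
      have hj := Finset.mem_range_succ_iff.1 hj
      have := sub_mem (ha (N - j) (Nat.sub_le _ _)) (hb (N - j) (Nat.sub_le _ _))
      rwa [Nat.sub_sub_self hj] at this) (by
      rw [Finset.sum_sub_distrib, sub_eq_zero]
      have ha' := Finset.sum_range_reflect a (N + 1)
      have hb' := Finset.sum_range_reflect b (N + 1)
      simp only [Nat.add_sub_cancel] at ha' hb'
      rw [ha', hb', h]) (N - r) (Finset.mem_range_succ_iff.2 (Nat.sub_le _ _))
  simpa only [Nat.sub_sub_self hr, sub_eq_zero] using key

lemma IsSymmAlg.induction_homogeneous (hS : IsSymmAlg k L S ι) {motive : S → Prop}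
    (mem : ∀ n, ∀ x ∈ Sdeg k L S ι n, motive x) (zero : motive 0)
    (add : ∀ x y, motive x → motive y → motive (x + y)) (x : S) : motive x :=
  Submodule.iSup_induction _ (motive := motive)
    (hS.iSup_Sdeg ▸ Submodule.mem_top : x ∈ ⨆ n, Sdeg k L S ι n)
    mem zero add

lemma IsPBWComponents.finite_support (hB : IsPBWComponents k L S ι e B) (hS : IsSymmAlg k L S ι)
    (x y : S) : (Function.support fun p : ℕ => B p x y).Finite := by
  induction x using hS.induction_homogeneous with
  | zero => simp
  | add u v hu hv =>
    refine (hu.union hv).subset fun p hp => ?_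
    contrapose! hp
    simp_all
  | mem n x hx =>
    induction y using hS.induction_homogeneous with
    | zero => simp
    | add u v hu hv =>
      refine (hu.union hv).subset fun p hp => ?_
      contrapose! hp
      simp_all
    | mem m y hy =>
      refine (Finset.range (n + m + 1)).finite_toSet.subset fun p hp => ?_
      contrapose! hp
      simpa using hB.2.1 p n m (by simpa using hp) x hx y hy

/-- The product `x ⋆_t y = ∑ B_p(x, y) t ^ p` as a bilinear map. -/
def starProduct (hfin : ∀ x y : S, (Function.support fun p : ℕ => B p x y).Finite) (t : k) :
    S →ₗ[k] S →ₗ[k] S :=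
  have hfin' (x y : S) : (Function.support fun p : ℕ => t ^ p • B p x y).Finite :=
    (hfin x y).subset fun p hp hp' => hp (by simp [show B p x y = 0 from hp'])
  LinearMap.mk₂ k (fun x y => ∑ᶠ p : ℕ, t ^ p • B p x y)
    (fun x x' y => by
      simp only [map_add, LinearMap.add_apply, smul_add]
      exact finsum_add_distrib (hfin' x y) (hfin' x' y))
    (fun c x y => by
      simp only [map_smul, LinearMap.smul_apply, smul_comm _ c]
      exact (smul_finsum c _).symm)
    (fun x y y' => by
      simp only [map_add, smul_add]
      exact finsum_add_distrib (hfin' x y) (hfin' x y'))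
    (fun c x y => by
      simp only [map_smul, smul_comm _ c]
      exact (smul_finsum c _).symm)

lemma starProduct_apply (hfin : ∀ x y : S, (Function.support fun p : ℕ => B p x y).Finite) (t : k)
    (x y : S) : starProduct hfin t x y = ∑ᶠ p : ℕ, t ^ p • B p x y :=
  rfl

variable (hfin : ∀ x y : S, (Function.support fun p : ℕ => B p x y).Finite)

namespace IsPBWComponents

lemma starProduct_eq_sum (hB : IsPBWComponents k L S ι e B) (t : k) {n m K : ℕ} (hK : n + m < K)
    {x y : S} (hx : x ∈ Sdeg k L S ι n) (hy : y ∈ Sdeg k L S ι m) :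
    starProduct hfin t x y = ∑ p ∈ Finset.range K, t ^ p • B p x y := by
  rw [starProduct_apply]
  refine finsum_eq_sum_of_support_subset _ fun p hp => ?_
  contrapose! hp
  have hp : K ≤ p := by simpa using hp
  simp [hB.2.1 p n m (by omega) x hx y hy]

lemma apply_starProduct_one (hB : IsPBWComponents k L S ι e B) (hS : IsSymmAlg k L S ι)
    (x y : S) : e (starProduct hfin 1 x y) = e x * e y := by
  induction x using hS.induction_homogeneous with
  | zero => simp
  | add u v hu hv => simp [hu, hv, add_mul]
  | mem n x hx =>
    induction y using hS.induction_homogeneous with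
    | zero => simp
    | add u v hu hv => simp [hu, hv, mul_add]
    | mem m y hy =>
      rw [hB.starProduct_eq_sum hfin 1 (Nat.lt_succ_self _) hx hy]
      simpa using hB.2.2 n m x hx y hy

/-- The leading component of the product is the commutative product. -/
lemma zero_apply [CharZero k] (hB : IsPBWComponents k L S ι e B)
    (he : IsSymmetrization k L S ι e) (hinj : Function.Injective e) {n m : ℕ} {x y : S}
    (hx : x ∈ Sdeg k L S ι n) (hy : y ∈ Sdeg k L S ι m) : B 0 x y = x * y := by
  have hxy : x * y ∈ Sdeg k L S ι (n + m) := by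
    rw [Sdeg, pow_add]; exact Submodule.mul_mem_mul hx hy
  have h := he.mul_sub_apply_mul_mem hx hy
  rw [← hB.2.2 n m x hx y hy, ← map_sub, Submodule.mem_map] at h
  obtain ⟨w, hw, hwe⟩ := h
  rw [hinj hwe, Finset.sum_range_succ'] at hw
  have hlow : ∑ p ∈ Finset.range (n + m), B (p + 1) x y ∈
      ⨆ i, ⨆ (_ : i < n + m), Sdeg k L S ι i := by
    refine Submodule.sum_mem _ fun p hp => Submodule.mem_iSup_of_mem (n + m - (p + 1)) ?_
    have := Finset.mem_range.1 hp
    exact Submodule.mem_iSup_of_mem (by omega) (hB.1 _ n m x hx y hy)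
  have hdiff : B 0 x y - x * y ∈ ⨆ i, ⨆ (_ : i < n + m), Sdeg k L S ι i := by
    have := sub_mem hw hlow
    rwa [add_sub_assoc, add_sub_cancel_left] at this
  have hle : ⨆ i, ⨆ (_ : i < n + m), Sdeg k L S ι i ≤ ⨆ i, ⨆ (_ : i ≠ n + m), Sdeg k L S ι i :=
    iSup_mono fun i => iSup_const_mono fun h => h.ne
  exact sub_eq_zero.1 (Submodule.disjoint_def.1 (he.iSupIndep_Sdeg hinj (n + m)) _
    (sub_mem (hB.1 0 n m x hx y hy) hxy) (hle hdiff))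

lemma starProduct_zero [CharZero k] (hB : IsPBWComponents k L S ι e B) (hS : IsSymmAlg k L S ι)
    (he : IsSymmetrization k L S ι e) (hinj : Function.Injective e) (x y : S) :
    starProduct hfin 0 x y = x * y := by
  induction x using hS.induction_homogeneous with
  | zero => simp
  | add u v hu hv => simp [hu, hv, add_mul]
  | mem n x hx =>
    induction y using hS.induction_homogeneous with
    | zero => simp
    | add u v hu hv => simp [hu, hv, mul_add]
    | mem m y hy =>
      rw [hB.starProduct_eq_sum hfin 0 (Nat.lt_succ_self _) hx hy, Finset.sum_range_succ']
      simp [hB.zero_apply he hinj hx hy]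

/-- If `e` is multiplicative on a pair of homogeneous elements, then so are all the products
`⋆_t`. -/
lemma starProduct_eq_mul [CharZero k] (hB : IsPBWComponents k L S ι e B)
    (he : IsSymmetrization k L S ι e) (hinj : Function.Injective e) (t : k) {n m : ℕ} {x y : S}
    (hx : x ∈ Sdeg k L S ι n) (hy : y ∈ Sdeg k L S ι m) (hmul : e (x * y) = e x * e y) :
    starProduct hfin t x y = x * y := by
  have hxy : x * y ∈ Sdeg k L S ι (n + m) := by
    rw [Sdeg, pow_add]; exact Submodule.mul_mem_mul hx hy
  have hcomp {r : ℕ} (hr : r ≤ n + m) : B r x y = if r = 0 then x * y else 0 :=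
    eq_of_sum_range_eq_of_mem_Sdeg (he.iSupIndep_Sdeg hinj)
      (a := fun r => B r x y) (b := fun r => if r = 0 then x * y else 0)
      (fun r _ => hB.1 r n m x hx y hy)
      (fun r _ => by split_ifs with h <;> simp [h, hxy])
      (hinj (by rw [hB.2.2 n m x hx y hy, ← hmul]; simp)) hr
  rw [hB.starProduct_eq_sum hfin t (Nat.lt_succ_self _) hx hy, Finset.sum_range_succ',
    Finset.sum_eq_zero fun p hp => by
      rw [hcomp (by have := Finset.mem_range.1 hp; omega)]; simp]
  simp [hcomp]

lemma comp_left_mem (hB : IsPBWComponents k L S ι e B) (p q : ℕ) {n m l : ℕ} {x y z : S}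
    (hx : x ∈ Sdeg k L S ι n) (hy : y ∈ Sdeg k L S ι m) (hz : z ∈ Sdeg k L S ι l) :
    B p (B q x y) z ∈ Sdeg k L S ι (n + m + l - (p + q)) := by
  by_cases hq : n + m < q
  · simp [hB.2.1 q n m hq x hx y hy]
  · have := hB.1 p _ l _ (hB.1 q n m x hx y hy) z hz
    rwa [show n + m - q + l - p = n + m + l - (p + q) by omega] at this

lemma comp_left_eq_zero (hB : IsPBWComponents k L S ι e B) {p q n m l : ℕ} {x y z : S}
    (hx : x ∈ Sdeg k L S ι n) (hy : y ∈ Sdeg k L S ι m) (hz : z ∈ Sdeg k L S ι l)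
    (h : n + m + l < p + q) : B p (B q x y) z = 0 := by
  by_cases hq : n + m < q
  · simp [hB.2.1 q n m hq x hx y hy]
  · exact hB.2.1 p _ l (by omega) _ (hB.1 q n m x hx y hy) z hz

lemma comp_right_mem (hB : IsPBWComponents k L S ι e B) (p q : ℕ) {n m l : ℕ} {x y z : S}
    (hx : x ∈ Sdeg k L S ι n) (hy : y ∈ Sdeg k L S ι m) (hz : z ∈ Sdeg k L S ι l) :
    B p x (B q y z) ∈ Sdeg k L S ι (n + m + l - (p + q)) := by
  by_cases hq : m + l < q
  · simp [hB.2.1 q m l hq y hy z hz]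
  · have := hB.1 p n _ x hx _ (hB.1 q m l y hy z hz)
    rwa [show n + (m + l - q) - p = n + m + l - (p + q) by omega] at this

lemma comp_right_eq_zero (hB : IsPBWComponents k L S ι e B) {p q n m l : ℕ} {x y z : S}
    (hx : x ∈ Sdeg k L S ι n) (hy : y ∈ Sdeg k L S ι m) (hz : z ∈ Sdeg k L S ι l)
    (h : n + m + l < p + q) : B p x (B q y z) = 0 := by
  by_cases hq : m + l < q
  · simp [hB.2.1 q m l hq y hy z hz]
  · exact hB.2.1 p n _ (by omega) x hx _ (hB.1 q m l y hy z hz)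

lemma starProduct_starProduct_left (hB : IsPBWComponents k L S ι e B) (t : k) {n m l : ℕ}
    {x y z : S} (hx : x ∈ Sdeg k L S ι n) (hy : y ∈ Sdeg k L S ι m) (hz : z ∈ Sdeg k L S ι l) :
    starProduct hfin t (starProduct hfin t x y) z = ∑ r ∈ Finset.range (n + m + l + 1),
      t ^ r • ∑ pq ∈ Finset.HasAntidiagonal.antidiagonal r, B pq.1 (B pq.2 x y) z := by
  rw [hB.starProduct_eq_sum hfin t (K := n + m + l + 1) (by omega) hx hy, map_sum,
    LinearMap.sum_apply]
  trans ∑ q ∈ Finset.range (n + m + l + 1), ∑ p ∈ Finset.range (n + m + l + 1),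
    t ^ (p + q) • B p (B q x y) z
  · refine Finset.sum_congr rfl fun q _ => ?_
    rw [map_smul, LinearMap.smul_apply, hB.starProduct_eq_sum hfin t (K := n + m + l + 1)
      (by omega) (hB.1 q n m x hx y hy) hz, Finset.smul_sum]
    exact Finset.sum_congr rfl fun p _ => by rw [smul_smul, ← pow_add, add_comm]
  · rw [Finset.sum_range_sum_range_eq_sum_antidiagonal _
      (fun p q => t ^ (p + q) • B p (B q x y) z)
      fun p q h => by rw [hB.comp_left_eq_zero hx hy hz h, smul_zero]]
    refine Finset.sum_congr rfl fun r _ => ?_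
    rw [Finset.smul_sum]
    exact Finset.sum_congr rfl fun pq h => by rw [Finset.HasAntidiagonal.mem_antidiagonal.1 h]

lemma starProduct_starProduct_right (hB : IsPBWComponents k L S ι e B) (t : k) {n m l : ℕ}
    {x y z : S} (hx : x ∈ Sdeg k L S ι n) (hy : y ∈ Sdeg k L S ι m) (hz : z ∈ Sdeg k L S ι l) :
    starProduct hfin t x (starProduct hfin t y z) = ∑ r ∈ Finset.range (n + m + l + 1),
      t ^ r • ∑ pq ∈ Finset.HasAntidiagonal.antidiagonal r, B pq.1 x (B pq.2 y z) := by
  rw [hB.starProduct_eq_sum hfin t (K := n + m + l + 1) (by omega) hy hz, map_sum]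
  trans ∑ q ∈ Finset.range (n + m + l + 1), ∑ p ∈ Finset.range (n + m + l + 1),
    t ^ (p + q) • B p x (B q y z)
  · refine Finset.sum_congr rfl fun q hq => ?_
    by_cases hq : m + l < q
    · simp [hB.2.1 q m l hq y hy z hz]
    rw [map_smul, hB.starProduct_eq_sum hfin t (K := n + m + l + 1)
      (by omega) hx (hB.1 q m l y hy z hz), Finset.smul_sum]
    exact Finset.sum_congr rfl fun p _ => by rw [smul_smul, ← pow_add, add_comm]
  · rw [Finset.sum_range_sum_range_eq_sum_antidiagonal _
      (fun p q => t ^ (p + q) • B p x (B q y z))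
      fun p q h => by rw [hB.comp_right_eq_zero hx hy hz h, smul_zero]]
    refine Finset.sum_congr rfl fun r _ => ?_
    rw [Finset.smul_sum]
    exact Finset.sum_congr rfl fun pq h => by rw [Finset.HasAntidiagonal.mem_antidiagonal.1 h]

/-- Associativity of `⋆_1` transported from the enveloping algebra, compared degree by degree,
yields associativity of `⋆_t`. -/
lemma starProduct_assoc [CharZero k] (hB : IsPBWComponents k L S ι e B) (hS : IsSymmAlg k L S ι)
    (he : IsSymmetrization k L S ι e) (hinj : Function.Injective e) (t : k) (x y z : S) :
    starProduct hfin t (starProduct hfin t x y) z =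
      starProduct hfin t x (starProduct hfin t y z) := by
  induction x using hS.induction_homogeneous with
  | zero => simp
  | add u v hu hv => simp [hu, hv]
  | mem n x hx =>
  induction y using hS.induction_homogeneous with
  | zero => simp
  | add u v hu hv => simp [hu, hv]
  | mem m y hy =>
  induction z using hS.induction_homogeneous with
  | zero => simp
  | add u v hu hv => simp [hu, hv]
  | mem l z hz =>
  have hone : starProduct hfin 1 (starProduct hfin 1 x y) z =
      starProduct hfin 1 x (starProduct hfin 1 y z) :=
    hinj (by simp only [hB.apply_starProduct_one hfin hS, mul_assoc])
  rw [hB.starProduct_starProduct_left hfin 1 hx hy hz,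
    hB.starProduct_starProduct_right hfin 1 hx hy hz] at hone
  simp only [one_pow, one_smul] at hone
  rw [hB.starProduct_starProduct_left hfin t hx hy hz,
    hB.starProduct_starProduct_right hfin t hx hy hz]
  refine Finset.sum_congr rfl fun r hr => congrArg (t ^ r • ·) ?_
  refine eq_of_sum_range_eq_of_mem_Sdeg (he.iSupIndep_Sdeg hinj)
    (a := fun r => ∑ pq ∈ Finset.HasAntidiagonal.antidiagonal r, B pq.1 (B pq.2 x y) z)
    (b := fun r => ∑ pq ∈ Finset.HasAntidiagonal.antidiagonal r, B pq.1 x (B pq.2 y z))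
    (fun r _ => Submodule.sum_mem _ fun pq h => ?_)
    (fun r _ => Submodule.sum_mem _ fun pq h => ?_) hone (Finset.mem_range_succ_iff.1 hr)
  · rw [← Finset.HasAntidiagonal.mem_antidiagonal.1 h]
    exact hB.comp_left_mem _ _ hx hy hz
  · rw [← Finset.HasAntidiagonal.mem_antidiagonal.1 h]
    exact hB.comp_right_mem _ _ hx hy hz

end IsPBWComponents

end Star

/-- The PBW quantization: for each `t ∈ k` the product
`x ⋆_t y = ∑_{p=0}^∞ B_p(x,y) t^p` (a finite sum for each pair `x, y`) makes `S𝔤` into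
an associative unital `k`-algebra; moreover `⋆_0` is the commutative product of `S𝔤`
and `x ⋆_1 y = B(x,y) = e⁻¹(e(x)e(y))`. -/
theorem star_t_associative_unital (k : Type) [Field k] [CharZero k]
    (L : Type) [LieRing L] [LieAlgebra k L]
    (S : Type) [CommRing S] [Algebra k S] (ι : L →ₗ[k] S)
    (hS : IsSymmAlg k L S ι)
    (e : S →ₗ[k] UniversalEnvelopingAlgebra k L)
    (he : IsSymmetrization k L S ι e) (hbij : Function.Bijective e)
    (B : ℕ → S →ₗ[k] S →ₗ[k] S) (hB : IsPBWComponents k L S ι e B) :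
    -- the sum `∑_p B_p(x,y) t^p` is finite for each pair `x, y`
    (∀ x y : S, (Function.support fun p : ℕ => B p x y).Finite) ∧
    ∀ t : k,
      -- `⋆_t` is associative ...
      (∀ x y z : S,
          (∑ᶠ p : ℕ, t ^ p • B p (∑ᶠ q : ℕ, t ^ q • B q x y) z) =
          (∑ᶠ p : ℕ, t ^ p • B p x (∑ᶠ q : ℕ, t ^ q • B q y z))) ∧
      -- ... and unital with unit `1`,
      (∀ x : S, (∑ᶠ p : ℕ, t ^ p • B p 1 x) = x) ∧
      (∀ x : S, (∑ᶠ p : ℕ, t ^ p • B p x 1) = x) ∧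
      -- `⋆_0` is the commutative product of `S𝔤`,
      (∀ x y : S, (∑ᶠ p : ℕ, (0 : k) ^ p • B p x y) = x * y) ∧
      -- and `x ⋆_1 y = B(x,y) = e⁻¹(e(x)e(y))`.
      (∀ x y : S, (∑ᶠ p : ℕ, (1 : k) ^ p • B p x y) =
          (LinearEquiv.ofBijective e hbij).symm (e x * e y)) := by
  have hinj := hbij.injective
  have hfin := hB.finite_support hS
  have he1 : e 1 = 1 := by simpa using he []
  have h1 : (1 : S) ∈ Sdeg k L S ι 0 := Submodule.one_le.1 (pow_zero _).ge
  refine ⟨hfin, fun t => ⟨fun x y z => hB.starProduct_assoc hfin hS he hinj t x y z,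
    fun x => ?_, fun x => ?_, fun x y => hB.starProduct_zero hfin hS he hinj x y,
    fun x y => ?_⟩⟩
  · rw [← starProduct_apply hfin]
    induction x using hS.induction_homogeneous with
    | zero => simp
    | add u v hu hv => rw [map_add, hu, hv]
    | mem n x hx =>
      rw [hB.starProduct_eq_mul hfin he hinj t h1 hx (by rw [he1, one_mul, one_mul]), one_mul]
  · rw [← starProduct_apply hfin]
    induction x using hS.induction_homogeneous with
    | zero => simp
    | add u v hu hv => rw [map_add, LinearMap.add_apply, hu, hv]
    | mem n x hx =>
      rw [hB.starProduct_eq_mul hfin he hinj t hx h1 (by rw [he1, mul_one, mul_one]), mul_one]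
  · rw [LinearEquiv.eq_symm_apply, LinearEquiv.ofBijective_apply, ← starProduct_apply hfin,
      hB.apply_starProduct_one hfin hS]

end
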